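/- Let α ∈ (0, 1) ∪ (1, ∞), let ρ, σ be positive semidefinite complex n×n matrices with ρ ≠ 0, and let (ψ_k)_{k=1..n} be an orthonormal basis of ℂⁿ consisting of eigenvectors of σ. Define the pinching E_σ(ρ) = ∑_k ⟨ψ_k, ρ ψ_k⟩ · |ψ_k⟩⟨ψ_k|. Then D̃_α(E_σ(ρ) ‖ σ) ≤ D̃_α(ρ ‖ σ) in ℝ ∪ {+∞}. -/

import Mathlib

open Matrix
open scoped Kronecker Classical ComplexOrder

/-- Real power of a matrix via functional calculus on the eigenvalues of a Hermitian
matrix, with the convention that eigenvalue `0` is mapped to `0` (powers are taken on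
the support). Non-Hermitian matrices are mapped to `0`. -/
noncomputable def matPow {n : Type*} [Fintype n] [DecidableEq n]
    (A : Matrix n n ℂ) (t : ℝ) : Matrix n n ℂ :=
  if hA : A.IsHermitian then
    (hA.eigenvectorUnitary : Matrix n n ℂ) *
      Matrix.diagonal (fun i =>
        ((if hA.eigenvalues i = 0 then (0 : ℝ) else hA.eigenvalues i ^ t : ℝ) : ℂ)) *
      (star (hA.eigenvectorUnitary : Matrix n n ℂ))
  else 0

/-- `dominates σ ρ` (written `σ ≫ ρ` in the paper): the kernel of `σ` is contained in
the kernel of `ρ`. -/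
def dominates {n : Type*} [Fintype n] (σ ρ : Matrix n n ℂ) : Prop :=
  ∀ v : n → ℂ, σ.mulVec v = 0 → ρ.mulVec v = 0

/-- The sandwiched Rényi divergence of order `α`, with values in `ℝ ∪ {+∞}` (as a
subset of `EReal`), logarithms base 2. It is `+∞` unless `ρ` is not orthogonal to `σ`
(i.e. `Tr[ρσ] ≠ 0`) and (`σ ≫ ρ` or `α < 1`). -/
noncomputable def Dtilde {n : Type*} [Fintype n] [DecidableEq n]
    (α : ℝ) (ρ σ : Matrix n n ℂ) : EReal :=
  if (ρ * σ).trace ≠ 0 ∧ (dominates σ ρ ∨ α < 1) then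
    (((α - 1)⁻¹ * Real.logb 2
        ((matPow (matPow σ ((1 - α) / (2 * α)) * ρ * matPow σ ((1 - α) / (2 * α))) α).trace.re
          / ρ.trace.re) : ℝ) : EReal)
  else ⊤

/-- The scalar function underlying `matPow`. -/
noncomputable def suppPow (t x : ℝ) : ℝ := if x = 0 then 0 else x ^ t

theorem matPow_conj_diagonal {n : Type*} [Fintype n] [DecidableEq n]
    {V : Matrix n n ℂ} (hV : Vᴴ * V = 1) (d : n → ℝ) (t : ℝ) :
    matPow (V * diagonal (fun i => (d i : ℂ)) * Vᴴ) t =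
      V * diagonal (fun i => (suppPow t (d i) : ℂ)) * Vᴴ := by
  have hV' : V * Vᴴ = 1 := mul_eq_one_comm.mp hV
  have hA : (V * diagonal (fun i => (d i : ℂ)) * Vᴴ).IsHermitian := by
    apply isHermitian_mul_mul_conjTranspose
    rw [isHermitian_diagonal_iff]
    intro i
    simp [IsSelfAdjoint]
  rw [matPow, dif_pos hA]
  have hspec := hA.spectral_theorem
  rw [Unitary.conjStarAlgAut_apply] at hspec
  set U : Matrix n n ℂ := (hA.eigenvectorUnitary : Matrix n n ℂ) with hUdef
  have hU : star U * U = 1 := Unitary.coe_star_mul_self hA.eigenvectorUnitary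
  have hU' : U * star U = 1 := Unitary.coe_mul_star_self hA.eigenvectorUnitary
  set l := hA.eigenvalues with hl
  clear_value U l
  have hW : diagonal (fun i => (l i : ℂ)) * (star U * V) =
      (star U * V) * diagonal (fun i => (d i : ℂ)) := by
    calc diagonal (fun i => (l i : ℂ)) * (star U * V)
        = star U * (U * diagonal (fun i => (l i : ℂ)) * star U) * V := by
          simp only [← Matrix.mul_assoc, hU, Matrix.one_mul]
      _ = star U * (V * diagonal (fun i => (d i : ℂ)) * Vᴴ) * V := by
          rw [hspec]; rfl
      _ = _ := by
          simp only [Matrix.mul_assoc, hV, Matrix.mul_one]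
  have hW' : diagonal (fun i => (suppPow t (l i) : ℂ)) * (star U * V) =
      (star U * V) * diagonal (fun i => (suppPow t (d i) : ℂ)) := by
    ext i j
    have h := congrFun (congrFun hW i) j
    rw [diagonal_mul, mul_diagonal] at h ⊢
    by_cases h0 : (star U * V) i j = 0
    · simp [h0]
    · rw [mul_comm] at h
      have : l i = d j := by exact_mod_cast mul_left_cancel₀ h0 h
      rw [this, mul_comm]
  calc U * diagonal (fun i => (suppPow t (l i) : ℂ)) * star U
      = U * (diagonal (fun i => (suppPow t (l i) : ℂ)) * (star U * V)) * Vᴴ := by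
        simp only [Matrix.mul_assoc, hV', Matrix.mul_one]
    _ = _ := by
        rw [hW']
        simp only [← Matrix.mul_assoc, hU', Matrix.one_mul]

theorem trace_conj_diagonal {n : Type*} [Fintype n] [DecidableEq n]
    {V : Matrix n n ℂ} (hV : Vᴴ * V = 1) (d : n → ℂ) :
    (V * diagonal d * Vᴴ).trace = ∑ i, d i := by
  rw [Matrix.trace_mul_comm, ← Matrix.mul_assoc, hV, Matrix.one_mul, trace_diagonal]

theorem suppPow_eq_rpow {t : ℝ} (ht : t ≠ 0) (x : ℝ) : suppPow t x = x ^ t := by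
  unfold suppPow
  split_ifs with h
  · rw [h, Real.zero_rpow ht]
  · rfl

/-- The diagonal of a positive semidefinite matrix in an orthonormal basis is the image of its
eigenvalues under a doubly stochastic matrix, and `matPow` acts on the eigenvalues. -/
theorem exists_doublyStochastic_eigenvalues {n : Type*} [Fintype n] [DecidableEq n]
    {A V : Matrix n n ℂ} (hA : A.PosSemidef) (hV : Vᴴ * V = 1) :
    ∃ (l : n → ℝ) (w : n → n → ℝ), (∀ i, 0 ≤ l i) ∧ (∀ k i, 0 ≤ w k i) ∧
      (∀ k, ∑ i, w k i = 1) ∧ (∀ i, ∑ k, w k i = 1) ∧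
      (∀ k, (Vᴴ * A * V) k k = ((∑ i, w k i * l i : ℝ) : ℂ)) ∧
      ∀ t, (matPow A t).trace.re = ∑ i, suppPow t (l i) := by
  have hspec := hA.isHermitian.spectral_theorem
  rw [Unitary.conjStarAlgAut_apply] at hspec
  set U : Matrix n n ℂ := (hA.isHermitian.eigenvectorUnitary : Matrix n n ℂ) with hUdef
  have hU : Uᴴ * U = 1 := Unitary.coe_star_mul_self hA.isHermitian.eigenvectorUnitary
  have hU' : U * Uᴴ = 1 := Unitary.coe_mul_star_self hA.isHermitian.eigenvectorUnitary
  have hV' : V * Vᴴ = 1 := mul_eq_one_comm.mp hV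
  have hl := hA.eigenvalues_nonneg
  set l := hA.isHermitian.eigenvalues with hldef
  have hspec' : A = U * diagonal (fun i => (l i : ℂ)) * Uᴴ := hspec
  clear_value U l
  have hWW : (Vᴴ * U) * (Vᴴ * U)ᴴ = 1 := by
    rw [conjTranspose_mul, conjTranspose_conjTranspose, Matrix.mul_assoc, ← Matrix.mul_assoc U,
      hU', Matrix.one_mul, hV]
  have hWW' : (Vᴴ * U)ᴴ * (Vᴴ * U) = 1 := mul_eq_one_comm.mp hWW
  refine ⟨l, fun k i => Complex.normSq ((Vᴴ * U) k i), hl, fun k i => Complex.normSq_nonneg _,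
    fun k => ?_, fun i => ?_, fun k => ?_, fun t => ?_⟩
  · have h := congrFun (congrFun hWW k) k
    simp only [mul_apply (M := Vᴴ * U), conjTranspose_apply, one_apply_eq] at h
    have h2 : ((∑ i, Complex.normSq ((Vᴴ * U) k i) : ℝ) : ℂ) = 1 := by
      rw [← h]; push_cast
      exact Finset.sum_congr rfl fun i _ => (Complex.mul_conj _).symm
    exact_mod_cast h2
  · have h := congrFun (congrFun hWW' i) i
    simp only [mul_apply (N := Vᴴ * U), conjTranspose_apply, one_apply_eq] at h
    have h2 : ((∑ k, Complex.normSq ((Vᴴ * U) k i) : ℝ) : ℂ) = 1 := by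
      rw [← h]; push_cast
      exact Finset.sum_congr rfl fun i _ => Complex.normSq_eq_conj_mul_self
    exact_mod_cast h2
  · have : Vᴴ * A * V = (Vᴴ * U) * diagonal (fun i => (l i : ℂ)) * (Vᴴ * U)ᴴ := by
      rw [hspec', conjTranspose_mul, conjTranspose_conjTranspose]
      simp only [Matrix.mul_assoc]
    rw [this, mul_apply]
    push_cast
    refine Finset.sum_congr rfl fun i _ => ?_
    rw [mul_diagonal, conjTranspose_apply, ← Complex.mul_conj]
    simp only [← starRingEnd_apply]
    ring
  · conv_lhs => rw [hspec']
    rw [matPow_conj_diagonal hU, trace_conj_diagonal hU, ← Complex.ofReal_sum, Complex.ofReal_re]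

theorem sum_rpow_doublyStochastic_le {n : Type*} [Fintype n] {α : ℝ} (hα : 1 ≤ α)
    {l : n → ℝ} {w : n → n → ℝ} (hl : ∀ i, 0 ≤ l i) (hw : ∀ k i, 0 ≤ w k i)
    (hrow : ∀ k, ∑ i, w k i = 1) (hcol : ∀ i, ∑ k, w k i = 1) :
    ∑ k, (∑ i, w k i * l i) ^ α ≤ ∑ i, l i ^ α := by
  calc ∑ k, (∑ i, w k i * l i) ^ α ≤ ∑ k, ∑ i, w k i * l i ^ α :=
        Finset.sum_le_sum fun k _ =>
          (convexOn_rpow hα).map_sum_le (fun i _ => hw k i) (hrow k) (fun i _ => hl i)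
    _ = ∑ i, l i ^ α := by
        rw [Finset.sum_comm]
        exact Finset.sum_congr rfl fun i _ => by rw [← Finset.sum_mul, hcol, one_mul]

theorem le_sum_rpow_doublyStochastic {n : Type*} [Fintype n] {α : ℝ} (h0 : 0 ≤ α) (h1 : α ≤ 1)
    {l : n → ℝ} {w : n → n → ℝ} (hl : ∀ i, 0 ≤ l i) (hw : ∀ k i, 0 ≤ w k i)
    (hrow : ∀ k, ∑ i, w k i = 1) (hcol : ∀ i, ∑ k, w k i = 1) :
    ∑ i, l i ^ α ≤ ∑ k, (∑ i, w k i * l i) ^ α := by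
  calc ∑ i, l i ^ α = ∑ k, ∑ i, w k i * l i ^ α := by
        rw [Finset.sum_comm]
        exact Finset.sum_congr rfl fun i _ => by rw [← Finset.sum_mul, hcol, one_mul]
    _ ≤ ∑ k, (∑ i, w k i * l i) ^ α :=
        Finset.sum_le_sum fun k _ =>
          (Real.concaveOn_rpow h0 h1).le_map_sum (fun i _ => hw k i) (hrow k) (fun i _ => hl i)

/-- The pinching inequality for a basis given by the columns of a unitary matrix. -/
theorem Dtilde_conj_diagonal_le {n : Type*} [Fintype n] [DecidableEq n] {α : ℝ}
    (hα : α ∈ Set.Ioo (0 : ℝ) 1 ∪ Set.Ioi 1) {ρ V : Matrix n n ℂ}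
    (hρ : ρ.PosSemidef) (hV : Vᴴ * V = 1) {m : n → ℝ} (hm : ∀ k, 0 ≤ m k) :
    Dtilde α (V * diagonal (fun k => (Vᴴ * ρ * V) k k) * Vᴴ)
        (V * diagonal (fun k => (m k : ℂ)) * Vᴴ)
      ≤ Dtilde α ρ (V * diagonal (fun k => (m k : ℂ)) * Vᴴ) := by
  have hV' : V * Vᴴ = 1 := mul_eq_one_comm.mp hV
  have hα0 : 0 < α := by
    rcases hα with h | h
    · exact h.1
    · exact one_pos.trans h
  have hnn : ∀ k, 0 ≤ (Vᴴ * ρ * V) k k := fun k =>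
    (hρ.conjTranspose_mul_mul_same V).diag_nonneg
  obtain ⟨r, hr⟩ : ∃ r : n → ℝ, ∀ k, (Vᴴ * ρ * V) k k = (r k : ℂ) :=
    ⟨fun k => ((Vᴴ * ρ * V) k k).re, fun k =>
      Complex.ext rfl (Complex.nonneg_iff.mp (hnn k)).2.symm⟩
  have hr0 : ∀ k, 0 ≤ r k := fun k => by have := hnn k; rw [hr] at this; exact_mod_cast this
  have htr : (V * diagonal (fun k => (Vᴴ * ρ * V) k k) * Vᴴ).trace = ρ.trace := by
    rw [trace_conj_diagonal hV]
    change (Vᴴ * ρ * V).trace = _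
    rw [Matrix.trace_mul_comm, ← Matrix.mul_assoc, hV', Matrix.one_mul]
  have htrσ : (ρ * (V * diagonal (fun k => (m k : ℂ)) * Vᴴ)).trace
      = ((∑ k, r k * m k : ℝ) : ℂ) := by
    have : ρ * (V * diagonal (fun k => (m k : ℂ)) * Vᴴ)
        = (ρ * V * diagonal (fun k => (m k : ℂ))) * Vᴴ := by simp only [Matrix.mul_assoc]
    rw [this, Matrix.trace_mul_comm, ← Matrix.mul_assoc, ← Matrix.mul_assoc, Matrix.trace]
    simp [mul_diagonal, hr]
  have htrσ' : (V * diagonal (fun k => (Vᴴ * ρ * V) k k) * Vᴴ *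
      (V * diagonal (fun k => (m k : ℂ)) * Vᴴ)).trace = ((∑ k, r k * m k : ℝ) : ℂ) := by
    have : V * diagonal (fun k => (Vᴴ * ρ * V) k k) * Vᴴ *
        (V * diagonal (fun k => (m k : ℂ)) * Vᴴ)
        = V * (diagonal (fun k => (Vᴴ * ρ * V) k k) * diagonal (fun k => (m k : ℂ))) * Vᴴ := by
      simp only [Matrix.mul_assoc]
      simp only [← Matrix.mul_assoc Vᴴ V, hV, Matrix.one_mul]
    rw [this, diagonal_mul_diagonal, trace_conj_diagonal hV]
    simp [hr]
  by_cases hc : (ρ * (V * diagonal (fun k => (m k : ℂ)) * Vᴴ)).trace ≠ 0 ∧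
      (dominates (V * diagonal (fun k => (m k : ℂ)) * Vᴴ) ρ ∨ α < 1)
  swap
  · rw [Dtilde, Dtilde, if_neg hc]
    exact le_top
  have hc' : (V * diagonal (fun k => (Vᴴ * ρ * V) k k) * Vᴴ *
      (V * diagonal (fun k => (m k : ℂ)) * Vᴴ)).trace ≠ 0 ∧
      (dominates (V * diagonal (fun k => (m k : ℂ)) * Vᴴ)
        (V * diagonal (fun k => (Vᴴ * ρ * V) k k) * Vᴴ) ∨ α < 1) := by
    refine ⟨by rw [htrσ', ← htrσ]; exact hc.1, hc.2.imp_left fun hd v hv => ?_⟩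
    have h1 : diagonal (fun k => (m k : ℂ)) *ᵥ (Vᴴ *ᵥ v) = 0 := by
      have := congrArg (Vᴴ *ᵥ ·) hv
      simpa only [mulVec_mulVec, ← Matrix.mul_assoc, hV, Matrix.one_mul, mulVec_zero] using this
    have h2 : diagonal (fun k => (Vᴴ * ρ * V) k k) *ᵥ (Vᴴ *ᵥ v) = 0 := by
      ext k
      have h3 := congrFun h1 k
      rw [mulVec_diagonal, Pi.zero_apply] at h3 ⊢
      rcases mul_eq_zero.mp h3 with h4 | h4
      · have h5 : ρ *ᵥ (V *ᵥ Pi.single k 1) = 0 := by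
          apply hd
          rw [mulVec_mulVec, Matrix.mul_assoc, hV, Matrix.mul_one, ← mulVec_mulVec,
            diagonal_mulVec_single, h4, zero_mul, Pi.single_zero, mulVec_zero]
        have h6 : (Vᴴ * ρ * V) *ᵥ Pi.single k 1 = 0 := by
          rw [← mulVec_mulVec, ← mulVec_mulVec, h5, mulVec_zero]
        have h7 := congrFun h6 k
        rw [mulVec_single_one] at h7
        simp only [col_apply, Pi.zero_apply] at h7
        rw [h7, zero_mul]
      · rw [h4, mul_zero]
    rw [Matrix.mul_assoc, ← mulVec_mulVec, ← mulVec_mulVec, h2, mulVec_zero]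
  rw [Dtilde, Dtilde, if_pos hc, if_pos hc', EReal.coe_le_coe_iff, htr,
    matPow_conj_diagonal hV]
  set s := (1 - α) / (2 * α)
  set S : Matrix n n ℂ := diagonal (fun k => (suppPow s (m k) : ℂ)) with hS
  have hSH : Sᴴ = S := by
    rw [hS, diagonal_conjTranspose]
    congr 1; ext k; simp
  have hA : (V * S * Vᴴ * ρ * (V * S * Vᴴ)).PosSemidef := by
    have := hρ.mul_mul_conjTranspose_same (V * S * Vᴴ)
    simpa only [conjTranspose_mul, conjTranspose_conjTranspose, hSH, Matrix.mul_assoc] using this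
  have hdiag : ∀ k, (Vᴴ * (V * S * Vᴴ * ρ * (V * S * Vᴴ)) * V) k k
      = ((suppPow s (m k) ^ 2 * r k : ℝ) : ℂ) := by
    intro k
    have : Vᴴ * (V * S * Vᴴ * ρ * (V * S * Vᴴ)) * V = S * (Vᴴ * ρ * V) * S := by
      simp only [Matrix.mul_assoc, hV, Matrix.mul_one]
      simp only [← Matrix.mul_assoc, hV, Matrix.one_mul]
    rw [this, hS, mul_diagonal, diagonal_mul, hr]
    push_cast; ring
  have hpinch : V * S * Vᴴ * (V * diagonal (fun k => (Vᴴ * ρ * V) k k) * Vᴴ) * (V * S * Vᴴ)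
      = V * diagonal (fun k => ((suppPow s (m k) ^ 2 * r k : ℝ) : ℂ)) * Vᴴ := by
    have : V * S * Vᴴ * (V * diagonal (fun k => (Vᴴ * ρ * V) k k) * Vᴴ) * (V * S * Vᴴ)
        = V * (S * diagonal (fun k => (Vᴴ * ρ * V) k k) * S) * Vᴴ := by
      simp only [Matrix.mul_assoc]
      simp only [← Matrix.mul_assoc Vᴴ V, hV, Matrix.one_mul]
    rw [this, hS, diagonal_mul_diagonal, diagonal_mul_diagonal]
    congr 3; ext k; rw [hr]; push_cast; ring
  obtain ⟨l, w, hl, hw, hrow, hcol, hd, ht⟩ := exists_doublyStochastic_eigenvalues hA hV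
  have hwl : ∀ k, suppPow s (m k) ^ 2 * r k = ∑ i, w k i * l i := fun k => by
    exact_mod_cast (hdiag k).symm.trans (hd k)
  rw [hpinch, matPow_conj_diagonal hV, trace_conj_diagonal hV, ← Complex.ofReal_sum,
    Complex.ofReal_re, ht]
  simp only [suppPow_eq_rpow hα0.ne', hwl]
  have hne : ∑ k, r k * m k ≠ 0 := by
    have := hc.1; rw [htrσ] at this; exact_mod_cast this
  obtain ⟨k, -, hk⟩ := Finset.exists_ne_zero_of_sum_ne_zero hne
  have hρpos : 0 < ρ.trace.re := by
    rw [← htr, trace_conj_diagonal hV]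
    simp only [hr, ← Complex.ofReal_sum, Complex.ofReal_re]
    exact Finset.sum_pos' (fun k _ => hr0 k)
      ⟨k, Finset.mem_univ _, (hr0 k).lt_of_ne (left_ne_zero_of_mul hk).symm⟩
  have hfk : 0 < ∑ i, w k i * l i := by
    rw [← hwl, suppPow, if_neg (right_ne_zero_of_mul hk)]
    have hmk : 0 < m k := (hm k).lt_of_ne (right_ne_zero_of_mul hk).symm
    have hrk : 0 < r k := (hr0 k).lt_of_ne (left_ne_zero_of_mul hk).symm
    positivity
  have hwl0 : ∀ k, 0 ≤ ∑ i, w k i * l i := fun k =>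
    Finset.sum_nonneg fun i _ => mul_nonneg (hw k i) (hl i)
  have hpos : 0 < ∑ k, (∑ i, w k i * l i) ^ α :=
    Finset.sum_pos' (fun k _ => Real.rpow_nonneg (hwl0 k) α)
      ⟨k, Finset.mem_univ _, Real.rpow_pos_of_pos hfk α⟩
  have hpos' : 0 < ∑ i, l i ^ α := by
    obtain ⟨i, -, hi⟩ := Finset.exists_ne_zero_of_sum_ne_zero hfk.ne'
    exact Finset.sum_pos' (fun i _ => Real.rpow_nonneg (hl i) α)
      ⟨i, Finset.mem_univ _,
        Real.rpow_pos_of_pos ((hl i).lt_of_ne (right_ne_zero_of_mul hi).symm) α⟩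
  rcases hα with h | h
  · refine mul_le_mul_of_nonpos_left ?_ (inv_nonpos.mpr (sub_nonpos.mpr h.2.le))
    refine Real.logb_le_logb_of_le one_lt_two (div_pos hpos' hρpos) ?_
    refine div_le_div_of_nonneg_right ?_ hρpos.le
    exact le_sum_rpow_doublyStochastic h.1.le h.2.le hl hw hrow hcol
  · refine mul_le_mul_of_nonneg_left ?_ (inv_nonneg.mpr (sub_nonneg.mpr (le_of_lt h)))
    refine Real.logb_le_logb_of_le one_lt_two (div_pos hpos hρpos) ?_
    refine div_le_div_of_nonneg_right ?_ hρpos.le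
    exact sum_rpow_doublyStochastic_le (le_of_lt h) hl hw hrow hcol

/-- pinching in an eigenbasis of `σ` can only decrease the sandwiched
Rényi divergence to `σ`. -/
theorem stmt9 {n : ℕ} {α : ℝ} (hα : α ∈ Set.Ioo (0 : ℝ) 1 ∪ Set.Ioi 1)
    {ρ σ : Matrix (Fin n) (Fin n) ℂ}
    (hρ : ρ.PosSemidef) (hσ : σ.PosSemidef) (hρ0 : ρ ≠ 0)
    (ψ : Fin n → (Fin n → ℂ))
    (hortho : ∀ k l, star (ψ k) ⬝ᵥ ψ l = if k = l then 1 else 0)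
    (heig : ∀ k, ∃ μ : ℝ, σ.mulVec (ψ k) = (μ : ℂ) • ψ k) :
    Dtilde α
        (∑ k, (star (ψ k) ⬝ᵥ ρ.mulVec (ψ k)) • Matrix.vecMulVec (ψ k) (star (ψ k))) σ
      ≤ Dtilde α ρ σ := by
  set V : Matrix (Fin n) (Fin n) ℂ := of fun i k => ψ k i with hVdef
  have hV : Vᴴ * V = 1 := by
    ext k l
    rw [one_apply, ← hortho k l]
    rfl
  have hV' : V * Vᴴ = 1 := mul_eq_one_comm.mp hV
  choose m hm using heig
  have hdiag : ∀ (B : Matrix (Fin n) (Fin n) ℂ) k,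
      (Vᴴ * B * V) k k = star (ψ k) ⬝ᵥ B.mulVec (ψ k) := by
    intro B k
    rw [Matrix.mul_assoc]
    rfl
  have hσV : σ = V * diagonal (fun k => (m k : ℂ)) * Vᴴ := by
    have : σ * V = V * diagonal (fun k => (m k : ℂ)) := by
      ext i k
      have h := congrFun (hm k) i
      rw [mul_diagonal, mul_comm]
      exact h
    rw [← this, Matrix.mul_assoc, hV', Matrix.mul_one]
  have hm0 : ∀ k, 0 ≤ m k := by
    intro k
    have h := (hσ.conjTranspose_mul_mul_same V).diag_nonneg (i := k)
    rw [hdiag, hm, dotProduct_smul, hortho, if_pos rfl, smul_eq_mul, mul_one] at h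
    exact_mod_cast h
  have hP : ∑ k, (star (ψ k) ⬝ᵥ ρ.mulVec (ψ k)) • Matrix.vecMulVec (ψ k) (star (ψ k))
      = V * diagonal (fun k => (Vᴴ * ρ * V) k k) * Vᴴ := by
    ext i j
    rw [mul_apply, Matrix.sum_apply]
    refine Finset.sum_congr rfl fun k _ => ?_
    rw [mul_diagonal, hdiag, conjTranspose_apply, Matrix.smul_apply, vecMulVec_apply, smul_eq_mul]
    simp only [hVdef, of_apply, Pi.star_apply]
    ring
  rw [hP, hσV]
  exact Dtilde_conj_diagonal_le hα hρ hV hm0
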